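/- arXiv:1112.1226 — 2 statements merged into one kernel-verified Lean document; each statement's English description precedes it below -/
import Mathlib

section
/- Let a, b, c, d : (0,∞) → ℝ be Borel measurable functions and suppose there is a measurable set M ⊆ (0,∞)² with l₂(M) = 0 such that a(x) + b(y) = c(x+y) + d(x/y) for all (x,y) ∈ (0,∞)² \ M. Then there exist real constants λ, κ₁, κ₂, α, β, γ, δ with α + β = γ + δ such that for Lebesgue-almost all x ∈ (0,∞): a(x) = λx + κ₁ log x + α, b(x) = λx + κ₂ log x + β, c(x) = λx + (κ₁+κ₂) log x + γ, and d(x) = κ₁ log(x/(x+1)) − κ₂ log(1+x) + δ. -/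
open MeasureTheory Set

namespace OB

noncomputable abbrev mp : Measure ℝ := volume.restrict (Ioi (0:ℝ))

instance : NeZero mp := ⟨by simp [mp]⟩

lemma qprod {f g : ℝ → ℝ} (hf : Measure.QuasiMeasurePreserving f mp mp)
    (hg : Measure.QuasiMeasurePreserving g mp mp) :
    Measure.QuasiMeasurePreserving (Prod.map f g) (mp.prod mp) (mp.prod mp) := by
  refine ⟨hf.measurable.prodMap hg.measurable, ?_⟩
  rw [← Measure.map_prod_map _ _ hf.measurable hg.measurable]
  exact hf.absolutelyContinuous.prod hg.absolutelyContinuous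

lemma qadd (u : ℝ) (hu : 0 ≤ u) : Measure.QuasiMeasurePreserving (fun x : ℝ => x + u) mp mp := by
  refine (quasiMeasurePreserving_add_right volume u).restrict ?_
  intro x hx
  simp only [mem_Ioi] at *
  linarith

lemma qmul (t : ℝ) (ht : 0 < t) : Measure.QuasiMeasurePreserving (fun x : ℝ => t * x) mp mp := by
  have : Measure.QuasiMeasurePreserving (fun x : ℝ => t * x) volume volume := by
    refine ⟨by fun_prop, ?_⟩
    rw [Real.map_volume_mul_left ht.ne']
    exact Measure.smul_absolutelyContinuous
  refine this.restrict ?_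
  intro x hx
  simp only [mem_Ioi] at *
  positivity

lemma sepconst {F G : ℝ → ℝ} (h : ∀ᵐ p ∂(mp.prod mp), F p.1 = G p.2) :
    ∃ k, (∀ᵐ x ∂mp, F x = k) ∧ (∀ᵐ x ∂mp, G x = k) := by
  have h1 := Measure.ae_ae_of_ae_prod h
  obtain ⟨x0, hx0⟩ := h1.exists
  refine ⟨F x0, ?_, ?_⟩
  · filter_upwards [h1] with x hx
    obtain ⟨y, hy, hy'⟩ := (hx.and hx0).exists
    simp only at hy hy'
    rw [hy, hy']
  · filter_upwards [hx0] with y hy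
    exact hy.symm

lemma aeswap {p : ℝ × ℝ → Prop} (h : ∀ᵐ z ∂(mp.prod mp), p z) :
    ∀ᵐ z ∂(mp.prod mp), p z.swap :=
  Measure.measurePreserving_swap.quasiMeasurePreserving.ae h

lemma lin {g : ℝ → ℝ} (hg : Measurable g) (h : ∀ u v, 0 ≤ u → 0 ≤ v → g (u + v) = g u + g v) :
    ∀ u, 0 ≤ u → g u = g 1 * u := by
  have h0 : g 0 = 0 := by
    have := h 0 0 le_rfl le_rfl
    simp at this
    exact this
  let G : ℝ →+ ℝ := 
    { toFun := fun u => g (max u 0) - g (max (-u) 0)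
      map_zero' := by simp
      map_add' := by
        intro u v
        have e : max (u+v) 0 + (max (-u) 0 + max (-v) 0)
            = max (-(u+v)) 0 + (max u 0 + max v 0) := by
          have : ∀ w : ℝ, max w 0 = w + max (-w) 0 := by
            intro w
            rcases le_total w 0 with hw | hw
            · rw [max_eq_right hw, max_eq_left (by linarith)]; ring
            · rw [max_eq_left hw, max_eq_right (by linarith)]; ring
          rw [this (u+v), this u, this v]; ring
        have e2 := congrArg g e
        rw [h _ _ (by positivity) (by positivity), h _ _ (by positivity) (by positivity),
          h _ _ (by positivity) (by positivity), h _ _ (by positivity) (by positivity)] at e2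
        linarith }
  have hG : Measurable G := by
    change Measurable (fun u => g (max u 0) - g (max (-u) 0))
    exact (hg.comp (by fun_prop)).sub (hg.comp (by fun_prop))
  have hc : Continuous G := Measure.AddMonoidHom.continuous_of_measurable G hG
  intro u hu
  have hGn : ∀ u, 0 ≤ u → G u = g u := by
    intro u hu
    change g (max u 0) - g (max (-u) 0) = g u
    rw [max_eq_left hu, max_eq_right (by linarith), h0, sub_zero]
  have := map_real_smul G hc u 1
  simp only [smul_eq_mul, mul_one] at this
  rw [hGn u hu, hGn 1 zero_le_one] at this
  rw [this, mul_comm]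

lemma meas {φ : ℝ → ℝ → ℝ} (hφ : Measurable (Function.uncurry φ)) {g : ℝ → ℝ}
    (h : ∀ u, ∀ᵐ x ∂mp, φ u x = g u) : Measurable g := by
  let ν : Measure ℝ := volume.restrict (Ioc 0 1)
  have hν : ν ≤ mp := Measure.restrict_mono Ioc_subset_Ioi_self le_rfl
  have e : g = fun u => Real.tan (∫ x, Real.arctan (φ u x) ∂ν) := by
    funext u
    have : ∫ x, Real.arctan (φ u x) ∂ν = ∫ x, Real.arctan (g u) ∂ν := by
      apply integral_congr_ae
      filter_upwards [(ae_mono hν) (h u)] with x hx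
      rw [hx]
    rw [this]
    simp [ν, Measure.real, Real.tan_arctan]
  have m : Measurable fun u => ∫ x, Real.arctan (φ u x) ∂ν := by
    apply StronglyMeasurable.measurable
    apply StronglyMeasurable.integral_prod_right
    exact (Real.measurable_arctan.comp hφ).stronglyMeasurable
  rw [e]
  simp only [Real.tan_eq_sin_div_cos]
  exact (Real.measurable_sin.comp m).div (Real.measurable_cos.comp m)

lemma pexider {A B C : ℝ → ℝ} (hA : Measurable A) (hB : Measurable B)
    (h : ∀ᵐ p ∂(mp.prod mp), A p.1 + B p.2 = C (p.1 + p.2)) :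
    ∃ l α β, (∀ᵐ x ∂mp, A x = l * x + α) ∧ (∀ᵐ x ∂mp, B x = l * x + β) ∧
      (∀ᵐ x ∂mp, C x = l * x + (α + β)) := by
  have h3 : ∀ u : ℝ, ∃ k, (∀ᵐ x ∂mp, A (x + |u|) - A x = k) ∧
      (∀ᵐ x ∂mp, B (x + |u|) - B x = k) := by
    intro u
    apply sepconst (F := fun x => A (x + |u|) - A x) (G := fun x => B (x + |u|) - B x)
    have h1 := (qprod (qadd |u| (abs_nonneg u)) (Measure.QuasiMeasurePreserving.id mp)).ae h
    have h2 := (qprod (Measure.QuasiMeasurePreserving.id mp) (qadd |u| (abs_nonneg u))).ae h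
    filter_upwards [h1, h2] with p h1 h2
    simp only [Prod.map_fst, Prod.map_snd, id] at h1 h2
    have : p.1 + |u| + p.2 = p.1 + (p.2 + |u|) := by ring
    rw [this] at h1
    linarith
  choose g hgA hgB using h3
  have mg : Measurable g := by
    refine meas (φ := fun u x => A (x + |u|) - A x) ?_ hgA
    change Measurable (fun p : ℝ × ℝ => A (p.2 + |p.1|) - A p.2)
    refine (hA.comp ?_).sub (hA.comp measurable_snd)
    exact measurable_snd.add (measurable_fst.abs)
  have add : ∀ u v, 0 ≤ u → 0 ≤ v → g (u + v) = g u + g v := by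
    intro u v hu hv
    have h1 := (qadd u hu).ae (hgA v)
    obtain ⟨x, hx1, hx2, hx3⟩ := (h1.and ((hgA u).and (hgA (u+v)))).exists
    rw [abs_of_nonneg hu] at hx2
    rw [abs_of_nonneg hv] at hx1
    rw [abs_of_nonneg (add_nonneg hu hv), ← add_assoc] at hx3
    linarith
  have hl := lin mg add
  have key : ∀ D : ℝ → ℝ, Measurable D → (∀ u, ∀ᵐ x ∂mp, D (x + |u|) - D x = g u) →
      ∃ k, ∀ᵐ x ∂mp, D x = g 1 * x + k := by
    intro D hD hgD
    have h4 : ∀ᵐ p ∂(mp.prod mp), D (p.2 + p.1) - D p.2 = g 1 * p.1 := by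
      rw [Measure.ae_prod_iff_ae_ae]
      · filter_upwards [ae_restrict_mem measurableSet_Ioi] with u hu
        filter_upwards [hgD u] with x hx
        rw [abs_of_pos hu, hl u (le_of_lt hu)] at hx
        exact hx
      · apply measurableSet_eq_fun
        · exact (hD.comp (by fun_prop)).sub (hD.comp (by fun_prop))
        · fun_prop
    have h5 : ∀ᵐ p ∂(mp.prod mp), D p.1 - g 1 * p.1 = D p.2 - g 1 * p.2 := by
      filter_upwards [h4, aeswap h4] with p h4 h5
      simp only [Prod.fst_swap, Prod.snd_swap] at h5
      rw [add_comm] at h5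
      linarith
    obtain ⟨k, hk, _⟩ := sepconst (F := fun x => D x - g 1 * x) (G := fun x => D x - g 1 * x) h5
    refine ⟨k, ?_⟩
    filter_upwards [hk] with x hx
    linarith
  obtain ⟨α, hα⟩ := key A hA hgA
  obtain ⟨β, hβ⟩ := key B hB hgB
  refine ⟨g 1, α, β, hα, hβ, ?_⟩
  have hall : ∀ᵐ y ∂mp, ∀ᵐ x ∂mp, C (x + y) = g 1 * (x + y) + (α + β) := by
    have := Measure.ae_ae_of_ae_prod (aeswap h)
    filter_upwards [this, hβ] with y hy hy2
    filter_upwards [hy, hα] with x hx hx2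
    simp only [Prod.swap_prod_mk] at hx
    rw [← hx, hx2, hy2]; ring
  have hn : ∀ n : ℕ, ∃ y, 0 < y ∧ y < 1 / ((n:ℝ) + 1) ∧
      ∀ᵐ x ∂mp, C (x + y) = g 1 * (x + y) + (α + β) := by
    intro n
    have hs : volume.restrict (Ioo 0 (1 / ((n:ℝ) + 1))) ≤ mp :=
      Measure.restrict_mono Ioo_subset_Ioi_self le_rfl
    have : NeZero (volume.restrict (Ioo 0 (1 / ((n:ℝ) + 1)))) := ⟨by
      rw [Ne, Measure.restrict_eq_zero]
      have : (0:ℝ) < 1 / ((n:ℝ) + 1) := by positivity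
      rw [Real.volume_Ioo, sub_zero, ENNReal.ofReal_eq_zero]
      linarith⟩
    have hall' : ∀ᵐ y ∂(volume.restrict (Ioo 0 (1 / ((n:ℝ) + 1)))),
        ∀ᵐ x ∂mp, C (x + y) = g 1 * (x + y) + (α + β) := ae_mono hs hall
    obtain ⟨y, hy1, hy2⟩ := (hall'.and (ae_restrict_mem measurableSet_Ioo)).exists
    exact ⟨y, hy2.1, hy2.2, hy1⟩
  choose y hy0 hy1 hy2 using hn
  have hsh : ∀ n, ∀ᵐ z ∂volume, y n < z → C z = g 1 * z + (α + β) := by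
    intro n
    have := (ae_restrict_iff' measurableSet_Ioi).1 (hy2 n)
    have := (quasiMeasurePreserving_add_right volume (-(y n))).ae this
    filter_upwards [this] with z hz hlt
    have := hz (by simp only [mem_Ioi]; linarith)
    simpa using this
  rw [ae_restrict_iff' measurableSet_Ioi]
  filter_upwards [ae_all_iff.2 hsh] with z hz hz0
  obtain ⟨n, hn⟩ := exists_nat_one_div_lt (mem_Ioi.1 hz0)
  exact hz n ((hy1 n).trans hn)

lemma linAll {g : ℝ → ℝ} (hg : Measurable g) (h : ∀ u v, g (u + v) = g u + g v) :
    ∀ u, g u = g 1 * u := by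
  intro u
  have hl := lin hg (fun u v _ _ => h u v)
  rcases le_total 0 u with hu | hu
  · exact hl u hu
  · have h0 := hl 0 le_rfl
    have h1 := hl (-u) (by linarith)
    have h2 := h u (-u)
    rw [add_neg_cancel] at h2
    linarith

lemma affeq {l p l' p' : ℝ} (h : ∀ᵐ x ∂mp, l * x + p = l' * x + p') : l = l' ∧ p = p' := by
  obtain ⟨x, hx⟩ := h.exists
  have hne : ∀ᵐ y ∂mp, y ≠ x := Measure.ae_ne mp x
  obtain ⟨y, hy, hyx⟩ := (h.and hne).exists
  have e : (l - l') * (y - x) = 0 := by linarith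
  have hl : l = l' := by
    rcases mul_eq_zero.1 e with e | e
    · linarith
    · exact absurd (by linarith) hyx
  refine ⟨hl, ?_⟩
  subst hl
  linarith

lemma cocycle {D L P : ℝ → ℝ}
    (h : ∀ s, ∀ᵐ x ∂mp, D (Real.exp s * x) - D x = L s * x + P s) (s r : ℝ) :
    L (s + r) = L s * Real.exp r + L r ∧ P (s + r) = P s + P r := by
  apply affeq
  filter_upwards [(qmul (Real.exp r) (Real.exp_pos r)).ae (h s), h r, h (s + r)] with x h1 h2 h3
  have : Real.exp s * (Real.exp r * x) = Real.exp (s + r) * x := by rw [Real.exp_add]; ring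
  rw [this] at h1
  linarith

lemma addit {D L P : ℝ → ℝ} (hD : Measurable D)
    (h : ∀ s, ∀ᵐ x ∂mp, D (Real.exp s * x) - D x = L s * x + P s) (lam : ℝ)
    (hL : ∀ s, L s = lam * (Real.exp s - 1)) : ∃ k, ∀ s, P s = k * s := by
  refine ⟨P 1, linAll ?_ (fun s r => (cocycle h s r).2)⟩
  refine meas (φ := fun s x => D (Real.exp s * x) - D x - lam * (Real.exp s - 1) * x) ?_ ?_
  · change Measurable (fun p : ℝ × ℝ =>
      D (Real.exp p.1 * p.2) - D p.2 - lam * (Real.exp p.1 - 1) * p.2)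
    exact ((hD.comp (by fun_prop)).sub (hD.comp (by fun_prop))).sub (by fun_prop)
  · intro s
    filter_upwards [h s] with x hx
    rw [hx, hL]; ring

lemma final {D : ℝ → ℝ} (hD : Measurable D) (lam k : ℝ)
    (h : ∀ s, ∀ᵐ x ∂mp, D (Real.exp s * x) - D x = lam * (Real.exp s - 1) * x + k * s) :
    ∃ γ, ∀ᵐ x ∂mp, D x = lam * x + k * Real.log x + γ := by
  have h4 : ∀ᵐ p ∂(mp.prod mp),
      D (p.1 * p.2) - D p.2 = lam * (p.1 - 1) * p.2 + k * Real.log p.1 := by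
    rw [Measure.ae_prod_iff_ae_ae]
    · filter_upwards [ae_restrict_mem measurableSet_Ioi] with t ht
      filter_upwards [h (Real.log t)] with x hx
      rw [Real.exp_log (mem_Ioi.1 ht)] at hx
      exact hx
    · apply measurableSet_eq_fun
      · exact (hD.comp (by fun_prop)).sub (hD.comp (by fun_prop))
      · exact Measurable.add (by fun_prop) 
          (measurable_const.mul (Real.measurable_log.comp measurable_fst))
  have h5 : ∀ᵐ p ∂(mp.prod mp), D p.1 - lam * p.1 - k * Real.log p.1
      = D p.2 - lam * p.2 - k * Real.log p.2 := by
    filter_upwards [h4, aeswap h4] with p h4 h5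
    simp only [Prod.fst_swap, Prod.snd_swap] at h5
    rw [mul_comm p.2 p.1] at h5
    linarith
  obtain ⟨γ, hγ, _⟩ := sepconst (F := fun x => D x - lam * x - k * Real.log x)
    (G := fun x => D x - lam * x - k * Real.log x) h5
  refine ⟨γ, ?_⟩
  filter_upwards [hγ] with x hx
  linarith

end OB

theorem stmt_1 (a b c d : ℝ → ℝ)
    (ha : Measurable a) (hb : Measurable b) (hc : Measurable c) (hd : Measurable d)
    (M : Set (ℝ × ℝ)) (hM : MeasurableSet M) (hM0 : volume M = 0)
    (heq : ∀ x y : ℝ, 0 < x → 0 < y → (x, y) ∉ M →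
      a x + b y = c (x + y) + d (x / y)) :
    ∃ lam k₁ k₂ α β γ δ : ℝ, α + β = γ + δ ∧
      (∀ᵐ x : ℝ ∂volume, x ∈ Ioi (0 : ℝ) →
        a x = lam * x + k₁ * Real.log x + α ∧
        b x = lam * x + k₂ * Real.log x + β ∧
        c x = lam * x + (k₁ + k₂) * Real.log x + γ ∧
        d x = k₁ * Real.log (x / (x + 1)) - k₂ * Real.log (1 + x) + δ) := by
  have h : ∀ᵐ p ∂(OB.mp.prod OB.mp), a p.1 + b p.2 = c (p.1 + p.2) + d (p.1 / p.2) := by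
    rw [OB.mp, Measure.prod_restrict, ← Measure.volume_eq_prod,
      ae_restrict_iff' (measurableSet_Ioi.prod measurableSet_Ioi)]
    filter_upwards [measure_eq_zero_iff_ae_notMem.1 hM0] with p hp hpos
    exact heq p.1 p.2 hpos.1 hpos.2 hp
  have hs : ∀ s : ℝ, ∃ l α β,
      (∀ᵐ x ∂OB.mp, a (Real.exp s * x) - a x = l * x + α) ∧
      (∀ᵐ x ∂OB.mp, b (Real.exp s * x) - b x = l * x + β) ∧
      (∀ᵐ x ∂OB.mp, c (Real.exp s * x) - c x = l * x + (α + β)) := by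
    intro s
    refine OB.pexider (A := fun x => a (Real.exp s * x) - a x)
      (B := fun x => b (Real.exp s * x) - b x) (C := fun x => c (Real.exp s * x) - c x)
      ((ha.comp (by fun_prop)).sub ha) ((hb.comp (by fun_prop)).sub hb) ?_
    have q := OB.qmul _ (Real.exp_pos s)
    filter_upwards [h, (OB.qprod q q).ae h] with p h1 h2
    simp only [Prod.map_fst, Prod.map_snd] at h2
    rw [mul_div_mul_left _ _ (Real.exp_pos s).ne', ← mul_add] at h2
    linarith
  choose L P Q hP hQ hR using hs
  have hL : ∃ lam, ∀ s, L s = lam * (Real.exp s - 1) := by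
    have he : Real.exp 1 - 1 ≠ 0 := by
      have := Real.add_one_lt_exp (one_ne_zero)
      intro h
      linarith
    refine ⟨L 1 / (Real.exp 1 - 1), fun s => ?_⟩
    have h1 := (OB.cocycle hP s 1).1
    have h2 := (OB.cocycle hP 1 s).1
    rw [add_comm 1 s] at h2
    field_simp
    linarith
  obtain ⟨lam, hL⟩ := hL
  obtain ⟨k₁, hk₁⟩ := OB.addit ha hP lam hL
  obtain ⟨k₂, hk₂⟩ := OB.addit hb hQ lam hL
  obtain ⟨α, hα⟩ := OB.final ha lam k₁ (fun s => by rw [← hL, ← hk₁]; exact hP s)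
  obtain ⟨β, hβ⟩ := OB.final hb lam k₂ (fun s => by rw [← hL, ← hk₂]; exact hQ s)
  obtain ⟨γ, hγ⟩ := OB.final hc lam (k₁ + k₂)
    (fun s => by rw [← hL, add_mul, ← hk₁, ← hk₂]; exact hR s)
  have hδ : ∀ᵐ x ∂OB.mp,
      d x = k₁ * Real.log (x / (x + 1)) - k₂ * Real.log (1 + x) + (α + β - γ) := by
    -- c evaluated at x + y
    have hcs : ∀ᵐ y ∂OB.mp, ∀ᵐ x ∂OB.mp,
        c (x + y) = lam * (x + y) + (k₁ + k₂) * Real.log (x + y) + γ := by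
      filter_upwards [ae_restrict_mem measurableSet_Ioi] with y hy
      exact (OB.qadd y (le_of_lt hy)).ae hγ
    have h2 := Measure.ae_ae_of_ae_prod (OB.aeswap h)
    obtain ⟨y, hy, hcy, h2y, hby⟩ :=
      ((ae_restrict_mem measurableSet_Ioi).and (hcs.and (h2.and hβ))).exists
    have hy : 0 < y := hy
    have h3 : ∀ᵐ x ∂OB.mp, d (x / y) = k₁ * Real.log x + k₂ * Real.log y
        - (k₁ + k₂) * Real.log (x + y) + (α + β - γ) := by
      filter_upwards [hcy, h2y, hα] with x h1 h2 h3
      simp only [Prod.swap_prod_mk] at h2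
      linarith
    filter_upwards [(OB.qmul y hy).ae h3, ae_restrict_mem measurableSet_Ioi] with x hx hx0
    have hx0 : 0 < x := hx0
    have e : y * x + y = y * (x + 1) := by ring
    rw [mul_div_cancel_left₀ _ hy.ne', e, Real.log_mul hy.ne' hx0.ne',
      Real.log_mul hy.ne' (by positivity)] at hx
    rw [hx, Real.log_div hx0.ne' (by positivity), add_comm 1 x]
    ring
  refine ⟨lam, k₁, k₂, α, β, γ, α + β - γ, by ring, ?_⟩
  rw [← ae_restrict_iff' measurableSet_Ioi]
  filter_upwards [hα, hβ, hγ, hδ] with x h1 h2 h3 h4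
  exact ⟨h1, h2, h3, h4⟩
end

section
/- Let X and Y be independent positive random variables with strictly positive densities on (0,∞). If U = X + Y and V = X/(X+Y) are independent, then there exist positive numbers p, q, a such that X has the gamma distribution G(p,a) and Y has the gamma distribution G(q,a). -/
open MeasureTheory Set ProbabilityTheory

open Filter Topology

lemma aux_integrable_exp {Ω : Type*} [MeasurableSpace Ω] {μ : Measure Ω} [IsProbabilityMeasure μ]
    {X : Ω → ℝ} (hX : AEMeasurable X μ) (hpos : ∀ᵐ ω ∂μ, 0 < X ω) {t : ℝ} (ht : t ≤ 0) :
    Integrable (fun ω => Real.exp (t * X ω)) μ := by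
  refine Integrable.of_bound (by fun_prop) 1 ?_
  filter_upwards [hpos] with ω hω
  rw [Real.norm_eq_abs, abs_of_pos (Real.exp_pos _)]
  exact Real.exp_le_one_iff.2 (mul_nonpos_of_nonpos_of_nonneg ht hω.le)

lemma aux_interior {Ω : Type*} [MeasurableSpace Ω] {μ : Measure Ω} [IsProbabilityMeasure μ]
    {X : Ω → ℝ} (hX : AEMeasurable X μ) (hpos : ∀ᵐ ω ∂μ, 0 < X ω) {t : ℝ} (ht : t < 0) :
    t ∈ interior (integrableExpSet X μ) := by
  refine mem_interior.2 ⟨Iio 0, ?_, isOpen_Iio, ht⟩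
  intro s hs
  exact aux_integrable_exp hX hpos (le_of_lt hs)

lemma aux_tendsto_cmgf {μ : Measure ℝ} [IsProbabilityMeasure μ]
    (hpos : ∀ᵐ x ∂μ, 0 < x) (t : ℝ) :
    Tendsto (fun s : ℝ => complexMGF id μ (s + t * Complex.I)) (𝓝[<] 0)
      (𝓝 (charFun μ t)) := by
  rw [← complexMGF_id_mul_I]
  unfold complexMGF
  refine tendsto_integral_filter_of_dominated_convergence (fun _ => 1) ?_ ?_ (by simp) ?_
  · exact Eventually.of_forall fun s => by fun_prop
  · filter_upwards [self_mem_nhdsWithin] with s hs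
    filter_upwards [hpos] with x hx
    rw [Complex.norm_exp]
    simp
    exact mul_nonpos_of_nonpos_of_nonneg (le_of_lt hs) hx.le
  · refine Eventually.of_forall fun x => ?_
    have : ContinuousAt (fun s : ℝ => Complex.exp ((s + t * Complex.I) * ((id x : ℝ) : ℂ))) 0 := by
      fun_prop
    have h2 := this.tendsto.mono_left (nhdsWithin_le_nhds (s := Iio 0))
    simpa using h2

lemma aux_tendsto_mgf {Ω : Type*} [MeasurableSpace Ω] {μ : Measure Ω} [IsProbabilityMeasure μ]
    {X : Ω → ℝ} (hX : AEMeasurable X μ) (hpos : ∀ᵐ ω ∂μ, 0 < X ω) :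
    Tendsto (mgf X μ) (𝓝[<] 0) (𝓝 1) := by
  have h : Tendsto (fun s : ℝ => ∫ ω, Real.exp (s * X ω) ∂μ) (𝓝[<] 0) (𝓝 (∫ ω, (1:ℝ) ∂μ)) := by
    refine tendsto_integral_filter_of_dominated_convergence (fun _ => 1) ?_ ?_ (by simp) ?_
    · exact Eventually.of_forall fun s => by fun_prop
    · filter_upwards [self_mem_nhdsWithin] with s hs
      filter_upwards [hpos] with x hx
      rw [Real.norm_eq_abs, abs_of_pos (Real.exp_pos _)]
      exact Real.exp_le_one_iff.2 (mul_nonpos_of_nonpos_of_nonneg (le_of_lt hs) hx.le)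
    · refine Eventually.of_forall fun x => ?_
      have : ContinuousAt (fun s : ℝ => Real.exp (s * X x)) 0 := by
        fun_prop
      have h2 := this.tendsto.mono_left (nhdsWithin_le_nhds (s := Iio 0))
      simpa using h2
  simp only [integral_const, probReal_univ, smul_eq_mul, mul_one] at h
  exact h

lemma aux_unique {μ ν : Measure ℝ} [IsProbabilityMeasure μ] [IsProbabilityMeasure ν]
    (hμ : ∀ᵐ x ∂μ, 0 < x) (hν : ∀ᵐ x ∂ν, 0 < x)
    (h : ∀ t < 0, mgf id μ t = mgf id ν t) : μ = ν := by
  have key : EqOn (complexMGF id μ) (complexMGF id ν) {z | z.re < 0} := by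
    have h1 : AnalyticOnNhd ℂ (complexMGF id μ) {z | z.re < 0} :=
      analyticOnNhd_complexMGF.mono fun z hz => aux_interior aemeasurable_id hμ hz
    have h2 : AnalyticOnNhd ℂ (complexMGF id ν) {z | z.re < 0} :=
      analyticOnNhd_complexMGF.mono fun z hz => aux_interior aemeasurable_id hν hz
    refine AnalyticOnNhd.eqOn_of_preconnected_of_frequently_eq h1 h2
      (convex_halfSpace_re_lt 0).isPreconnected (z₀ := ((-1 : ℝ) : ℂ)) (by simp) ?_
    have h_real : ∃ᶠ (x : ℝ) in 𝓝[≠] (-1), complexMGF id μ x = complexMGF id ν x := by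
      refine Eventually.frequently ?_
      have : ∀ᶠ x : ℝ in 𝓝[≠] (-1), x < 0 :=
        nhdsWithin_le_nhds (Iio_mem_nhds (by norm_num))
      filter_upwards [this] with x hx
      rw [complexMGF_ofReal, complexMGF_ofReal, h x hx]
    rw [frequently_iff_seq_forall] at h_real ⊢
    obtain ⟨xs, hx_tendsto, hx_eq⟩ := h_real
    refine ⟨fun n ↦ xs n, ?_, fun n ↦ ?_⟩
    · rw [tendsto_nhdsWithin_iff] at hx_tendsto ⊢
      constructor
      · exact (Complex.continuous_ofReal.tendsto _).comp hx_tendsto.1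
      · filter_upwards [hx_tendsto.2] with n hn
        simp only [mem_compl_iff, mem_singleton_iff] at hn ⊢
        exact_mod_cast hn
    · simp [hx_eq]
  apply Measure.ext_of_charFun
  ext t
  refine tendsto_nhds_unique (aux_tendsto_cmgf hμ t) ((aux_tendsto_cmgf hν t).congr' ?_)
  filter_upwards [self_mem_nhdsWithin] with s hs
  exact (key (by simpa using hs)).symm

lemma aux_gamma_pos {p a : ℝ} : ∀ᵐ x ∂(gammaMeasure p a), 0 < x := by
  rw [ae_iff, gammaMeasure]
  have : {x : ℝ | ¬ 0 < x} = Iic 0 := by ext; simp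
  rw [this, withDensity_apply _ measurableSet_Iic, ← restrict_Iio_eq_restrict_Iic]
  exact lintegral_gammaPDF_of_nonpos le_rfl

lemma aux_gamma_mgf {p a t : ℝ} (hp : 0 < p) (ha : 0 < a) (ht : t < 0) :
    mgf id (gammaMeasure p a) t = (a / (a - t)) ^ p := by
  have hat : 0 < a - t := by linarith
  rw [mgf, gammaMeasure, integral_withDensity_eq_integral_toReal_smul₀]
  · have h1 : ∀ x : ℝ, (gammaPDF p a x).toReal • Real.exp (t * id x)
        = (Ici (0:ℝ)).indicator
          (fun x => (a ^ p / Real.Gamma p) * (x ^ (p - 1) * Real.exp (-((a - t) * x)))) x := by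
      intro x
      rw [gammaPDF, ENNReal.toReal_ofReal (gammaPDFReal_nonneg hp ha x)]
      by_cases hx : 0 ≤ x
      · rw [indicator_of_mem (by exact hx)]
        simp only [gammaPDFReal, if_pos hx, smul_eq_mul, id]
        rw [show -((a - t) * x) = -(a*x) + t * x by ring, Real.exp_add]
        ring
      · rw [indicator_of_notMem (by exact hx)]
        simp [gammaPDFReal, if_neg hx]
    simp_rw [h1]
    rw [integral_indicator measurableSet_Ici, integral_Ici_eq_integral_Ioi, integral_const_mul,
      Real.integral_rpow_mul_exp_neg_mul_Ioi hp hat, Real.div_rpow ha.le hat.le,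
      Real.div_rpow zero_le_one hat.le, Real.one_rpow]
    have := (Real.Gamma_pos_of_pos hp).ne'
    field_simp
  · exact (measurable_gammaPDFReal p a).ennreal_ofReal.aemeasurable
  · exact Eventually.of_forall fun x => by simp [gammaPDF]

/-- ODE lemma. -/
lemma aux_ode {F F' : ℝ → ℝ} {κ β c : ℝ} (hκ : 0 < κ) (hβ : 0 ≤ β) (hc : 0 < c)
    (hF : ∀ t < 0, HasDerivAt F (F' t) t) (hFpos : ∀ t < 0, 0 < F t)
    (hode : ∀ t < 0, F' t * (β - κ * t) = c * F t)
    (hlim : Tendsto F (𝓝[<] 0) (𝓝 1)) :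
    0 < β ∧ ∀ t < 0, F t = ((β / κ) / (β / κ - t)) ^ (c / κ) := by
  set r := c / κ with hr
  have hr0 : 0 < r := by positivity
  have hb : ∀ t < 0, 0 < β - κ * t := fun t ht => by nlinarith
  have hder : ∀ t < 0, HasDerivAt (fun t => F t * (β - κ * t) ^ r) 0 t := by
    intro t ht
    have h1 : HasDerivAt (fun t : ℝ => β - κ * t) (-κ) t := by
      simpa using ((hasDerivAt_id t).const_mul κ).const_sub β
    have h2 := (hF t ht).mul (h1.rpow_const (p := r) (Or.inl (hb t ht).ne'))
    convert! h2 using 1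
    have h3 : (β - κ * t) ^ r = (β - κ * t) ^ (r - 1) * (β - κ * t) := by
      rw [Real.rpow_sub_one (hb t ht).ne']
      field_simp [(hb t ht).ne']
    have h4 : κ * r = c := by rw [hr]; field_simp
    rw [h3]
    linear_combination (-(β - κ * t) ^ (r - 1)) * hode t ht + F t * (β - κ * t) ^ (r - 1) * h4
  have hconst : ∀ t < 0, F t * (β - κ * t) ^ r = F (-1) * (β - κ * (-1)) ^ r := by
    intro t ht
    have := (convex_Iio (0:ℝ)).is_const_of_fderivWithin_eq_zero (𝕜 := ℝ)
      (f := fun t => F t * (β - κ * t) ^ r)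
      (fun t ht => (hder t ht).differentiableAt.differentiableWithinAt) (fun t ht => by
        rw [fderivWithin_of_isOpen isOpen_Iio ht]
        ext
        simp [(hder t ht).deriv]) (show t ∈ Iio (0:ℝ) from ht) (show (-1:ℝ) ∈ Iio (0:ℝ) by simp)
    exact this
  have hlim2 : Tendsto (fun t => F t * (β - κ * t) ^ r) (𝓝[<] 0) (𝓝 (1 * β ^ r)) := by
    refine hlim.mul ?_
    have : ContinuousAt (fun t : ℝ => (β - κ * t) ^ r) 0 :=
      ContinuousAt.rpow_const (by fun_prop) (Or.inr hr0.le)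
    have h2 := this.tendsto.mono_left (nhdsWithin_le_nhds (s := Iio 0))
    simpa using h2
  have hC : F (-1) * (β - κ * (-1)) ^ r = β ^ r := by
    have : Tendsto (fun t => F t * (β - κ * t) ^ r) (𝓝[<] 0)
        (𝓝 (F (-1) * (β - κ * (-1)) ^ r)) := by
      refine tendsto_const_nhds.congr' ?_
      filter_upwards [self_mem_nhdsWithin] with t ht
      exact (hconst t ht).symm
    simpa using tendsto_nhds_unique this hlim2
  have hβpos : 0 < β := by
    rcases hβ.lt_or_eq with h | h
    · exact h
    · exfalso
      have h1 : 0 < F (-1) * (β - κ * (-1)) ^ r :=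
        mul_pos (hFpos _ (by norm_num)) (Real.rpow_pos_of_pos (hb _ (by norm_num)) _)
      rw [hC, ← h, Real.zero_rpow hr0.ne'] at h1
      exact lt_irrefl _ h1
  refine ⟨hβpos, fun t ht => ?_⟩
  have h5 : (β / κ) / (β / κ - t) = β / (β - κ * t) := by
    have h6 := (hb t ht).ne'
    have : β / κ - t = (β - κ * t) / κ := by field_simp
    rw [this]; field_simp
  rw [h5, Real.div_rpow hβpos.le (hb t ht).le, ← hC, ← hconst t ht]
  have := (Real.rpow_pos_of_pos (hb t ht) r).ne'
  field_simp

lemma aux_prod_int {Ω : Type*} [MeasurableSpace Ω] {μ : Measure Ω} [IsProbabilityMeasure μ]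
    {X Y : Ω → ℝ} (hX : Measurable X) (hY : Measurable Y) (h : IndepFun X Y μ) (t : ℝ) (i j : ℕ) :
    ∫ ω, (X ω ^ i * Real.exp (t * X ω)) * (Y ω ^ j * Real.exp (t * Y ω)) ∂μ =
    (∫ ω, X ω ^ i * Real.exp (t * X ω) ∂μ) * ∫ ω, Y ω ^ j * Real.exp (t * Y ω) ∂μ :=
  h.integral_fun_comp_mul_comp (f := fun x => x ^ i * Real.exp (t * x))
    (g := fun x => x ^ j * Real.exp (t * x)) hX.aemeasurable hY.aemeasurable
    (by fun_prop) (by fun_prop)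

lemma aux_prod_integrable {Ω : Type*} [MeasurableSpace Ω] {μ : Measure Ω} [IsProbabilityMeasure μ]
    {X Y : Ω → ℝ} (hX : Measurable X) (hY : Measurable Y)
    (hXpos : ∀ᵐ ω ∂μ, 0 < X ω) (hYpos : ∀ᵐ ω ∂μ, 0 < Y ω)
    (h : IndepFun X Y μ) {t : ℝ} (ht : t < 0) (i j : ℕ) :
    Integrable (fun ω => (X ω ^ i * Real.exp (t * X ω)) * (Y ω ^ j * Real.exp (t * Y ω))) μ := by
  have h1 : IndepFun (fun ω => X ω ^ i * Real.exp (t * X ω))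
      (fun ω => Y ω ^ j * Real.exp (t * Y ω)) μ :=
    h.comp (φ := fun x => x ^ i * Real.exp (t * x)) (ψ := fun x => x ^ j * Real.exp (t * x))
      (by fun_prop) (by fun_prop)
  exact h1.integrable_mul
    (integrable_pow_mul_exp_of_mem_interior_integrableExpSet
      (aux_interior hX.aemeasurable hXpos ht) i)
    (integrable_pow_mul_exp_of_mem_interior_integrableExpSet
      (aux_interior hY.aemeasurable hYpos ht) j)

lemma aux_UV {Ω : Type*} [MeasurableSpace Ω] {μ : Measure Ω} [IsProbabilityMeasure μ]
    {X Y : Ω → ℝ} (hX : Measurable X) (hY : Measurable Y)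
    (hXpos : ∀ᵐ ω ∂μ, 0 < X ω) (hYpos : ∀ᵐ ω ∂μ, 0 < Y ω)
    (hUV : IndepFun (fun ω => X ω + Y ω) (fun ω => X ω / (X ω + Y ω)) μ) (t : ℝ) (n : ℕ) :
    ∫ ω, (X ω ^ n * Real.exp (t * X ω)) * (Y ω ^ 0 * Real.exp (t * Y ω)) ∂μ =
    (∫ ω, (X ω / (X ω + Y ω)) ^ n ∂μ) *
      ∫ ω, (X ω + Y ω) ^ n * (Real.exp (t * X ω) * Real.exp (t * Y ω)) ∂μ := by
  have := hUV.integral_fun_comp_mul_comp (f := fun x => x ^ n * Real.exp (t * x))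
    (g := fun x => x ^ n) (by fun_prop) (by fun_prop) (by fun_prop) (by fun_prop)
  simp_rw [mul_add, Real.exp_add] at this
  rw [mul_comm, ← this]
  refine integral_congr_ae ?_
  filter_upwards [hXpos, hYpos] with ω h1 h2
  have : X ω + Y ω ≠ 0 := by positivity
  rw [div_pow]
  field_simp

lemma aux_rel {Ω : Type*} [MeasurableSpace Ω] {μ : Measure Ω} [IsProbabilityMeasure μ]
    {X Y : Ω → ℝ} (hX : Measurable X) (hY : Measurable Y)
    (hXpos : ∀ᵐ ω ∂μ, 0 < X ω) (hYpos : ∀ᵐ ω ∂μ, 0 < Y ω) (hindep : IndepFun X Y μ)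
    (hUV : IndepFun (fun ω => X ω + Y ω) (fun ω => X ω / (X ω + Y ω)) μ)
    (M : (Ω → ℝ) → ℕ → ℝ → ℝ)
    (hM : ∀ Z n t, M Z n t = ∫ ω, Z ω ^ n * Real.exp (t * Z ω) ∂μ) {t : ℝ} (ht : t < 0) :
    M X 1 t * M Y 0 t = (∫ ω, X ω / (X ω + Y ω) ∂μ) * (M X 1 t * M Y 0 t + M X 0 t * M Y 1 t) ∧
    M X 2 t * M Y 0 t = (∫ ω, (X ω / (X ω + Y ω)) ^ 2 ∂μ) *
      (M X 2 t * M Y 0 t + 2 * (M X 1 t * M Y 1 t) + M X 0 t * M Y 2 t) := by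
  have hI := aux_prod_integrable hX hY hXpos hYpos hindep ht
  simp only [hM, ← aux_prod_int hX hY hindep t]
  constructor
  · rw [← integral_add (hI 1 0) (hI 0 1), aux_UV hX hY hXpos hYpos hUV t 1]
    simp only [pow_one]
    congr 1
    refine integral_congr_ae (Eventually.of_forall fun ω => ?_)
    simp only
    ring
  · rw [← integral_const_mul 2,
      ← integral_add (hI 2 0) ((hI 1 1).const_mul 2),
      ← integral_add (by exact (hI 2 0).add ((hI 1 1).const_mul 2)) (hI 0 2),
      aux_UV hX hY hXpos hYpos hUV t 2]
    congr 1
    refine integral_congr_ae (Eventually.of_forall fun ω => ?_)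
    simp only
    ring

lemma aux_M_pos {Ω : Type*} [MeasurableSpace Ω] {μ : Measure Ω} [IsProbabilityMeasure μ]
    {X : Ω → ℝ} (hX : Measurable X)
    (hXpos : ∀ᵐ ω ∂μ, 0 < X ω) {t : ℝ} (ht : t < 0) (n : ℕ) :
    0 < ∫ ω, X ω ^ n * Real.exp (t * X ω) ∂μ := by
  rw [integral_pos_iff_support_of_nonneg_ae]
  · have : Function.support (fun ω => X ω ^ n * Real.exp (t * X ω)) =ᵐ[μ] univ := by
      rw [eventuallyEq_univ]
      filter_upwards [hXpos] with ω h
      simp only [Function.mem_support]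
      positivity
    rw [measure_congr this]; simp
  · filter_upwards [hXpos] with ω h
    simp only [Pi.zero_apply]
    positivity
  · exact integrable_pow_mul_exp_of_mem_interior_integrableExpSet
      (aux_interior hX.aemeasurable hXpos ht) n

lemma aux_V {Ω : Type*} [MeasurableSpace Ω] {μ : Measure Ω} [IsProbabilityMeasure μ]
    {V : Ω → ℝ} (hV : Measurable V) (h0 : ∀ᵐ ω ∂μ, 0 < V ω) (h1 : ∀ᵐ ω ∂μ, V ω < 1)
    (hnc : ∀ c < 1, ¬ ∀ᵐ ω ∂μ, V ω = c) :
    0 < ∫ ω, V ω ∂μ ∧ ∫ ω, V ω ∂μ < 1 ∧ ∫ ω, V ω ^ 2 ∂μ < ∫ ω, V ω ∂μ ∧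
      (∫ ω, V ω ∂μ) ^ 2 < ∫ ω, V ω ^ 2 ∂μ := by
  have hL : MemLp V 2 μ := by
    refine MemLp.of_bound (by fun_prop) 1 ?_
    filter_upwards [h0, h1] with ω a b
    rw [Real.norm_eq_abs, abs_of_pos a]; exact b.le
  have hI : Integrable V μ := hL.integrable (by norm_num)
  have hI2 : Integrable (fun ω => V ω ^ 2) μ := hL.integrable_sq
  have pos : ∀ f : Ω → ℝ, Integrable f μ → (∀ᵐ ω ∂μ, 0 < f ω) → 0 < ∫ ω, f ω ∂μ := by
    intro f hf hp
    rw [integral_pos_iff_support_of_nonneg_ae (hp.mono fun _ h => h.le) hf]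
    have : Function.support f =ᵐ[μ] univ := by
      rw [eventuallyEq_univ]
      filter_upwards [hp] with ω h
      exact h.ne'
    rw [measure_congr this]; simp
  have hA := pos V hI h0
  have hB : ∫ ω, V ω ∂μ < 1 := by
    have := pos (fun ω => 1 - V ω) ((integrable_const _).sub hI)
      (h1.mono fun _ h => sub_pos.2 h)
    rw [integral_sub (integrable_const _) hI] at this
    simp at this
    linarith
  refine ⟨hA, hB, ?_, ?_⟩
  · have := pos (fun ω => V ω - V ω ^ 2) (hI.sub hI2) (by
      filter_upwards [h0, h1] with ω a b
      nlinarith)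
    rw [integral_sub hI hI2] at this
    linarith
  · have h2 := variance_eq_sub hL
    have h3 : Var[V; μ] ≠ 0 := fun h => hnc _ hB (ae_eq_integral_of_variance_eq_zero hL h)
    have h4 := (variance_nonneg V μ).lt_of_ne' h3
    rw [h2] at h4
    simp only [Pi.pow_apply] at h4
    linarith

lemma aux_nonconst {Ω : Type*} [MeasurableSpace Ω] {μ : Measure Ω} [IsProbabilityMeasure μ]
    {X Y : Ω → ℝ} (hX : Measurable X) (hY : Measurable Y)
    (hXpos : ∀ᵐ ω ∂μ, 0 < X ω) (hYpos : ∀ᵐ ω ∂μ, 0 < Y ω) (hindep : IndepFun X Y μ)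
    (hac : Measure.map X μ ≪ volume) (c : ℝ) (hc : c < 1) :
    ¬ ∀ᵐ ω ∂μ, X ω / (X ω + Y ω) = c := by
  intro h
  have h1 : ∀ᵐ ω ∂μ, X ω = c / (1 - c) * Y ω := by
    filter_upwards [h, hXpos, hYpos] with ω a b d
    have : X ω + Y ω ≠ 0 := by positivity
    have h1c : 1 - c ≠ 0 := by linarith
    field_simp at a ⊢
    linarith
  have hm := (indepFun_iff_map_prod_eq_prod_map_map hX.aemeasurable hY.aemeasurable).1 hindep
  have : IsProbabilityMeasure (μ.map X) := Measure.isProbabilityMeasure_map hX.aemeasurable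
  have : IsProbabilityMeasure (μ.map Y) := Measure.isProbabilityMeasure_map hY.aemeasurable
  have hS : MeasurableSet {z : ℝ × ℝ | z.1 = c / (1 - c) * z.2} :=
    measurableSet_eq_fun (by fun_prop) (by fun_prop)
  have h2 : (μ.map (fun ω => (X ω, Y ω))) {z : ℝ × ℝ | z.1 = c / (1 - c) * z.2} = 1 := by
    rw [Measure.map_apply (by fun_prop) hS]
    rw [← measure_univ (μ := μ)]
    exact measure_congr (eventuallyEq_univ.2 h1)
  rw [hm, Measure.prod_apply_symm hS] at h2
  have h3 : ∀ y : ℝ, (μ.map X) ((fun x => (x, y)) ⁻¹' {z : ℝ × ℝ | z.1 = c / (1 - c) * z.2}) = 0 := by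
    intro y
    apply hac
    have : ((fun x => (x, y)) ⁻¹' {z : ℝ × ℝ | z.1 = c / (1 - c) * z.2}) = {c / (1 - c) * y} := by
      ext; simp
    rw [this]; simp
  simp only [h3, lintegral_zero] at h2
  exact zero_ne_one h2

theorem stmt_2 {Ω : Type*} [MeasureSpace Ω] [IsProbabilityMeasure (ℙ : Measure Ω)]
    (X Y : Ω → ℝ) (hX : Measurable X) (hY : Measurable Y)
    (hXpos : ∀ᵐ ω ∂ℙ, 0 < X ω) (hYpos : ∀ᵐ ω ∂ℙ, 0 < Y ω)
    (fX fY : ℝ → ℝ)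
    (hfX : Measure.map X ℙ = volume.withDensity (fun x => ENNReal.ofReal (fX x)))
    (hfY : Measure.map Y ℙ = volume.withDensity (fun x => ENNReal.ofReal (fY x)))
    (hfXpos : ∀ x : ℝ, 0 < x → 0 < fX x) (hfYpos : ∀ x : ℝ, 0 < x → 0 < fY x)
    (hfXsupp : ∀ x : ℝ, x ≤ 0 → fX x = 0) (hfYsupp : ∀ x : ℝ, x ≤ 0 → fY x = 0)
    (hindep : IndepFun X Y ℙ)
    (hUV : IndepFun (fun ω => X ω + Y ω) (fun ω => X ω / (X ω + Y ω)) ℙ) :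
    ∃ p q a : ℝ, 0 < p ∧ 0 < q ∧ 0 < a ∧
      Measure.map X ℙ = gammaMeasure p a ∧ Measure.map Y ℙ = gammaMeasure q a := by
  have hac : Measure.map X ℙ ≪ volume := hfX ▸ withDensity_absolutelyContinuous _ _
  obtain ⟨hm0, hm1, hm2, hm3⟩ := aux_V (μ := ℙ) (V := fun ω => X ω / (X ω + Y ω)) (by fun_prop)
    (by filter_upwards [hXpos, hYpos] with ω a b; positivity)
    (by
      filter_upwards [hXpos, hYpos] with ω a b
      rw [div_lt_one (by positivity)]; linarith)
    (fun c hc => aux_nonconst hX hY hXpos hYpos hindep hac c hc)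
  obtain ⟨M, hM⟩ : ∃ M : (Ω → ℝ) → ℕ → ℝ → ℝ,
    ∀ Z n t, M Z n t = ∫ ω, Z ω ^ n * Real.exp (t * Z ω) ∂ℙ := ⟨_, fun _ _ _ => rfl⟩
  have hrel := fun t (ht : t < 0) => aux_rel hX hY hXpos hYpos hindep hUV M hM ht
  set m1 := ∫ ω, X ω / (X ω + Y ω)
  set m2 := ∫ ω, (X ω / (X ω + Y ω)) ^ 2
  have hMX0 : M X 0 = mgf X ℙ := by ext t; simp [hM, mgf]
  have hMY0 : M Y 0 = mgf Y ℙ := by ext t; simp [hM, mgf]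
  have hdX : ∀ n, ∀ t < 0, HasDerivAt (M X n) (M X (n + 1) t) t := by
    intro n t ht
    have := hasDerivAt_integral_pow_mul_exp_real (aux_interior hX.aemeasurable hXpos ht) n
    rw [show M X n = _ from funext (hM X n), hM X (n+1) t]
    exact this
  have hdY : ∀ n, ∀ t < 0, HasDerivAt (M Y n) (M Y (n + 1) t) t := by
    intro n t ht
    have := hasDerivAt_integral_pow_mul_exp_real (aux_interior hY.aemeasurable hYpos ht) n
    rw [show M Y n = _ from funext (hM Y n), hM Y (n+1) t]
    exact this
  have hpX : ∀ n, ∀ t < 0, 0 < M X n t := fun n t ht => hM X n t ▸ aux_M_pos hX hXpos ht n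
  have hpY : ∀ n, ∀ t < 0, 0 < M Y n t := fun n t ht => hM Y n t ▸ aux_M_pos hY hYpos ht n
  -- differentiated first relation
  have hrel3 : ∀ t < 0, M X 2 t * M Y 0 t + M X 1 t * M Y 1 t =
      m1 * (M X 2 t * M Y 0 t + 2 * (M X 1 t * M Y 1 t) + M X 0 t * M Y 2 t) := by
    intro t ht
    have d1 := (hdX 1 t ht).mul (hdY 0 t ht)
    have d2 := ((d1.add ((hdX 0 t ht).mul (hdY 1 t ht))).const_mul m1)
    have heq : (M X 1 * M Y 0) =ᶠ[𝓝 t]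
        fun s => m1 * ((M X 1 * M Y 0) + (M X 0 * M Y 1)) s := by
      filter_upwards [Iio_mem_nhds ht] with s hs
      exact (hrel s hs).1
    have := (d1.congr_of_eventuallyEq heq.symm).unique d2
    norm_num at this
    linarith
  set κ := (m2 - m1 ^ 2) / (m1 * (m1 - m2)) with hκdef
  have hκ : 0 < κ := div_pos (by linarith) (mul_pos hm0 (by linarith))
  have hκ' : κ * (m1 * (m1 - m2)) = m2 - m1 ^ 2 :=
    div_mul_cancel₀ _ (mul_pos hm0 (by linarith)).ne'
  clear_value κ
  have hY1 : ∀ t < 0, m1 * (M X 0 t * M Y 1 t) = (1 - m1) * (M X 1 t * M Y 0 t) := by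
    intro t ht
    linarith [(hrel t ht).1]
  have hkey : ∀ t < 0, M X 1 t ^ 2 - M X 0 t * M X 2 t = - κ * M X 1 t ^ 2 := by
    intro t ht
    have a1 := (hrel t ht).2
    have a2 := hrel3 t ht
    have a3 := hY1 t ht
    have b0 := hpY 0 t ht
    -- m1 * A2 B = m2 (A2 B + A1 B1)
    have a4 : m1 * (M X 2 t * M Y 0 t) = m2 * (M X 2 t * M Y 0 t + M X 1 t * M Y 1 t) := by
      linear_combination m1 * a1 - m2 * a2
    have a5 : (m1 * (m1 - m2)) * (M X 0 t * M X 2 t) = m2 * (1 - m1) * M X 1 t ^ 2 := by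
      apply mul_right_cancel₀ b0.ne'
      linear_combination m1 * M X 0 t * a4 + m2 * M X 1 t * a3
    apply mul_left_cancel₀ (mul_pos hm0 (sub_pos.2 hm2)).ne'
    linear_combination - a5 + M X 1 t ^ 2 * hκ'
  have hR : ∃ β, ∀ t < 0, M X 0 t = (β - κ * t) * M X 1 t := by
    have hder : ∀ t < 0, HasDerivAt (fun t => M X 0 t / M X 1 t + κ * t) 0 t := by
      intro t ht
      have h1 := ((hdX 0 t ht).div (hdX 1 t ht) (hpX 1 t ht).ne').add
        ((hasDerivAt_id t).const_mul κ)
      convert! h1 using 1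
      have h2 := (hpX 1 t ht).ne'
      have h3 := hkey t ht
      norm_num
      field_simp
      linarith
    refine ⟨M X 0 (-1) / M X 1 (-1) + κ * (-1), fun t ht => ?_⟩
    have := (convex_Iio (0:ℝ)).is_const_of_fderivWithin_eq_zero (𝕜 := ℝ)
      (f := fun t => M X 0 t / M X 1 t + κ * t)
      (fun t ht => (hder t ht).differentiableAt.differentiableWithinAt) (fun t ht => by
        rw [fderivWithin_of_isOpen isOpen_Iio ht]
        ext
        simp [(hder t ht).deriv]) (show t ∈ Iio (0:ℝ) from ht) (show (-1:ℝ) ∈ Iio (0:ℝ) by simp)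
    rw [← this]
    have h2 := (hpX 1 t ht).ne'
    field_simp
    ring
  obtain ⟨β, hβ⟩ := hR
  have hβ0 : 0 ≤ β := by
    by_contra hneg
    push Not at hneg
    have ht : β / κ < 0 := div_neg_of_neg_of_pos hneg hκ
    have h1 := hβ _ ht
    have h2 := hpX 0 _ ht
    rw [mul_div_cancel₀ _ hκ.ne'] at h1
    simp at h1
    linarith
  have hc : 0 < (1 - m1) / m1 := div_pos (by linarith) hm0
  obtain ⟨hβpos, hFX⟩ := aux_ode (F := M X 0) (F' := M X 1) (c := 1) hκ hβ0 one_pos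
    (hdX 0) (hpX 0) (fun t ht => by rw [hβ t ht]; ring)
    (hMX0 ▸ aux_tendsto_mgf hX.aemeasurable hXpos)
  obtain ⟨-, hFY⟩ := aux_ode (F := M Y 0) (F' := M Y 1) (c := (1 - m1) / m1) hκ hβ0 hc
    (hdY 0) (hpY 0) (fun t ht => by
      have h1 := hY1 t ht
      have h2 := hpX 1 t ht
      rw [hβ t ht] at h1
      rw [div_mul_eq_mul_div (1 - m1) m1, eq_div_iff hm0.ne']
      apply mul_left_cancel₀ h2.ne'
      linarith)
    (hMY0 ▸ aux_tendsto_mgf hY.aemeasurable hYpos)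
  have hp : 0 < 1 / κ := by positivity
  have hq : 0 < (1 - m1) / m1 / κ := by positivity
  have ha : 0 < β / κ := by positivity
  have : IsProbabilityMeasure (Measure.map X ℙ) := Measure.isProbabilityMeasure_map hX.aemeasurable
  have : IsProbabilityMeasure (Measure.map Y ℙ) := Measure.isProbabilityMeasure_map hY.aemeasurable
  have := isProbabilityMeasure_gammaMeasure hp ha
  have := isProbabilityMeasure_gammaMeasure hq ha
  refine ⟨1 / κ, (1 - m1) / m1 / κ, β / κ, hp, hq, ha, ?_, ?_⟩
  · refine aux_unique ((ae_map_iff hX.aemeasurable measurableSet_Ioi).2 hXpos) aux_gamma_pos ?_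
    intro t ht
    rw [aux_gamma_mgf hp ha ht, ← hFX t ht, hMX0, mgf_id_map hX.aemeasurable]
  · refine aux_unique ((ae_map_iff hY.aemeasurable measurableSet_Ioi).2 hYpos) aux_gamma_pos ?_
    intro t ht
    rw [aux_gamma_mgf hq ha ht, ← hFY t ht, hMY0, mgf_id_map hY.aemeasurable]
end
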